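/- Let X = ℝⁿ with the Euclidean norm ‖·‖₂, Y a measurable space, and D a probability measure on X × Y. Let Adv : X → X be a measurable map (an adversarial attacker). Let S be a Markov kernel from X to probability measures on X, h : X × Y → [0,1] measurable, h̄(x,y) = ∫ h(x',y) dS(x)(x'), and let ψ : [0,∞) → [0,1] be concave and nondecreasing with TV(S(x₁), S(x₂)) ≤ ψ(‖x₁ − x₂‖₂) for all x₁, x₂ ∈ ℝⁿ. If ∫ ‖Adv(x) − x‖₂ dD(x,y) ≤ ε < ∞, then |∫ h̄(x,y) dD(x,y) − ∫ h̄(Adv(x), y) dD(x,y)| ≤ ψ(ε). -/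

import Mathlib

open MeasureTheory ProbabilityTheory
open scoped ENNReal

/-- Total variation distance between two measures:
the supremum over measurable sets `A` of `|μ A - ν A|`. -/
noncomputable def TV {α : Type*} [MeasurableSpace α] (μ ν : Measure α) : ℝ :=
  ⨆ A : {A : Set α // MeasurableSet A}, |(μ A.1).toReal - (ν A.1).toReal|

lemma ConcaveOn.exists_supergradient {s : Set ℝ} {φ : ℝ → ℝ} (hφ : ConcaveOn ℝ s φ) {m : ℝ}
    (hm : m ∈ interior s) : ∃ a : ℝ, ∀ t ∈ s, φ t ≤ φ m + a * (t - m) := by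
  obtain ⟨l, hl, hls⟩ := (mem_nhdsLT_iff_exists_Ico_subset (a := m)).1
    (mem_nhdsWithin_of_mem_nhds (mem_interior_iff_mem_nhds.1 hm))
  obtain ⟨u, hu, hus⟩ := (mem_nhdsGT_iff_exists_Ioc_subset (a := m)).1
    (mem_nhdsWithin_of_mem_nhds (mem_interior_iff_mem_nhds.1 hm))
  obtain ⟨a, ha₁, ha₂⟩ := exists_between_of_forall_le
    (s := (fun z => (φ z - φ m) / (z - m)) '' (s ∩ Set.Ioi m))
    (t := (fun x => (φ m - φ x) / (m - x)) '' (s ∩ Set.Iio m))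
    ⟨_, u, ⟨hus ⟨hu, le_rfl⟩, hu⟩, rfl⟩ ⟨_, l, ⟨hls ⟨le_rfl, hl⟩, hl⟩, rfl⟩ (by
      rintro _ ⟨z, ⟨hz, hmz⟩, rfl⟩ _ ⟨x, ⟨hx, hxm⟩, rfl⟩
      exact hφ.slope_anti_adjacent hx hz hxm hmz)
  refine ⟨a, fun t ht => ?_⟩
  rcases lt_trichotomy t m with htm | rfl | hmt
  · have := ha₂ ⟨t, ⟨ht, htm⟩, rfl⟩
    rw [le_div_iff₀ (sub_pos.2 htm)] at this
    linarith
  · simp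
  · have := ha₁ ⟨t, ⟨ht, hmt⟩, rfl⟩
    rw [div_le_iff₀ (sub_pos.2 hmt)] at this
    linarith

lemma abs_measureReal_sub_le_TV {α : Type*} [MeasurableSpace α] (μ ν : Measure α)
    [IsProbabilityMeasure μ] [IsProbabilityMeasure ν] {A : Set α} (hA : MeasurableSet A) :
    |μ.real A - ν.real A| ≤ TV μ ν := by
  refine le_ciSup (f := fun A : {A : Set α // MeasurableSet A} =>
    |(μ A.1).toReal - (ν A.1).toReal|) ⟨1, ?_⟩ ⟨A, hA⟩
  rintro _ ⟨B, rfl⟩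
  exact abs_sub_le_of_nonneg_of_le measureReal_nonneg measureReal_le_one
    measureReal_nonneg measureReal_le_one

lemma abs_integral_sub_integral_le_TV {α : Type*} [MeasurableSpace α] (μ ν : Measure α)
    [IsProbabilityMeasure μ] [IsProbabilityMeasure ν] {g : α → ℝ} (hg : Measurable g)
    (hg01 : ∀ a, g a ∈ Set.Icc (0 : ℝ) 1) :
    |∫ a, g a ∂μ - ∫ a, g a ∂ν| ≤ TV μ ν := by
  have layer (ρ : Measure α) [IsProbabilityMeasure ρ] :
      ∫ a, g a ∂ρ = ∫ t in (0 : ℝ)..1, ρ.real {a | t ≤ g a} := by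
    have h_int : Integrable g ρ := Integrable.of_mem_Icc 0 1 hg.aemeasurable (ae_of_all _ hg01)
    rw [h_int.integral_eq_integral_Ioc_meas_le (ae_of_all _ fun a => (hg01 a).1)
      (ae_of_all _ fun a => (hg01 a).2), intervalIntegral.integral_of_le zero_le_one]
  have layer_int (ρ : Measure α) [IsProbabilityMeasure ρ] :
      IntervalIntegrable (fun t => ρ.real {a | t ≤ g a}) volume 0 1 :=
    Antitone.intervalIntegrable fun s t hst =>
      measureReal_mono fun a (ha : t ≤ g a) => hst.trans ha
  rw [layer μ, layer ν, ← intervalIntegral.integral_sub (layer_int μ) (layer_int ν),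
    ← Real.norm_eq_abs]
  refine (intervalIntegral.norm_integral_le_of_norm_le_const fun t _ =>
    abs_measureReal_sub_le_TV μ ν (measurableSet_le measurable_const hg)).trans ?_
  simp

theorem population_level_adversarial_certificate
    {n : ℕ} {Y : Type*} [MeasurableSpace Y]
    (D : Measure (EuclideanSpace ℝ (Fin n) × Y)) [IsProbabilityMeasure D]
    (Adv : EuclideanSpace ℝ (Fin n) → EuclideanSpace ℝ (Fin n))
    (hAdv : Measurable Adv)
    (S : Kernel (EuclideanSpace ℝ (Fin n)) (EuclideanSpace ℝ (Fin n)))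
    [IsMarkovKernel S]
    (h : EuclideanSpace ℝ (Fin n) × Y → ℝ) (hmeas : Measurable h)
    (hrange : ∀ p, h p ∈ Set.Icc (0 : ℝ) 1)
    (hbar : EuclideanSpace ℝ (Fin n) × Y → ℝ)
    (hhbar : ∀ x y, hbar (x, y) = ∫ x', h (x', y) ∂(S x))
    (ψ : ℝ → ℝ)
    (hψ_mono : MonotoneOn ψ (Set.Ici 0))
    (hψ_conc : ConcaveOn ℝ (Set.Ici 0) ψ)
    (hψ_range : ∀ t ≥ (0 : ℝ), ψ t ∈ Set.Icc (0 : ℝ) 1)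
    (hTV : ∀ x₁ x₂ : EuclideanSpace ℝ (Fin n), TV (S x₁) (S x₂) ≤ ψ ‖x₁ - x₂‖)
    (ε : ℝ) (hε : 0 ≤ ε)
    (hW : ∫⁻ p, ENNReal.ofReal ‖Adv p.1 - p.1‖ ∂D ≤ ENNReal.ofReal ε) :
    |(∫ p, hbar p ∂D) - ∫ p, hbar (Adv p.1, p.2) ∂D| ≤ ψ ε := by
  have hκ : hbar = fun p => ∫ x', h (x', p.2) ∂(S.prodMkRight Y p) := by
    ext ⟨x, y⟩
    exact hhbar x y
  have hbar_meas : Measurable hbar := by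
    rw [hκ]
    exact (StronglyMeasurable.integral_kernel_prod_right' (κ := S.prodMkRight Y)
      (f := fun q => h (q.2, q.1.2)) (by fun_prop)).measurable
  have hbar_mem (p) : hbar p ∈ Set.Icc (0 : ℝ) 1 := by
    rw [hκ]
    have : Integrable (fun x' => h (x', p.2)) (S.prodMkRight Y p) :=
      Integrable.of_mem_Icc 0 1 (by fun_prop) (ae_of_all _ fun _ => hrange _)
    exact ⟨integral_nonneg fun _ => (hrange _).1,
      (integral_mono this (integrable_const 1) fun _ => (hrange _).2).trans (by simp)⟩
  have h_int : Integrable hbar D :=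
    Integrable.of_mem_Icc 0 1 hbar_meas.aemeasurable (ae_of_all _ hbar_mem)
  have hbarAdv_int : Integrable (fun p => hbar (Adv p.1, p.2)) D :=
    Integrable.of_mem_Icc 0 1 (by fun_prop) (ae_of_all _ fun _ => hbar_mem _)
  set f : EuclideanSpace ℝ (Fin n) × Y → ℝ := fun p => ‖Adv p.1 - p.1‖
  have hf_meas : Measurable f := by fun_prop
  have hf_nonneg (p) : 0 ≤ f p := norm_nonneg _
  have hf_int : Integrable f D :=
    (lintegral_ofReal_ne_top_iff_integrable hf_meas.aestronglyMeasurable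
      (ae_of_all _ hf_nonneg)).1 (ne_top_of_le_ne_top ENNReal.ofReal_ne_top hW)
  have hf_le : ∫ p, f p ∂D ≤ ε := by
    rw [integral_eq_lintegral_of_nonneg_ae (ae_of_all _ hf_nonneg) hf_meas.aestronglyMeasurable]
    exact ENNReal.toReal_le_of_le_ofReal hε hW
  have hpt (p) : ‖hbar p - hbar (Adv p.1, p.2)‖ ≤ ψ (f p) := by
    rw [Real.norm_eq_abs, ← Prod.mk.eta (p := p), hhbar, hhbar]
    refine (abs_integral_sub_integral_le_TV _ _ (by fun_prop) fun _ => hrange _).trans ?_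
    exact (hTV _ _).trans_eq (congrArg ψ (norm_sub_rev _ _))
  obtain ⟨a, ha⟩ : ∃ a : ℝ, 0 ≤ a ∧ ∀ᵐ p ∂D, ψ (f p) ≤ ψ ε + a * (f p - ε) := by
    rcases hε.eq_or_lt with rfl | hpos
    · have h0 : f =ᵐ[D] 0 := (integral_eq_zero_iff_of_nonneg hf_nonneg hf_int).1
        (hf_le.antisymm (integral_nonneg hf_nonneg))
      refine ⟨0, le_rfl, ?_⟩
      filter_upwards [h0] with p hp
      simp [hp]
    · obtain ⟨a, ha⟩ := hψ_conc.exists_supergradient (m := ε) (by simpa using hpos)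
      refine ⟨a, ?_, ae_of_all _ fun p => ha _ (hf_nonneg p)⟩
      have h1 : ε + 1 ∈ Set.Ici (0 : ℝ) := by simp; linarith
      have h2 := hψ_mono (Set.mem_Ici.2 hε) h1 (by linarith)
      have h3 := ha _ h1
      linarith
  rw [← integral_sub h_int hbarAdv_int, ← Real.norm_eq_abs]
  calc ‖∫ p, (hbar p - hbar (Adv p.1, p.2)) ∂D‖
      ≤ ∫ p, (ψ ε + a * (f p - ε)) ∂D :=
        norm_integral_le_of_norm_le (by fun_prop)
          (ha.2.mono fun p hp => (hpt p).trans hp)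
    _ = ψ ε + a * (∫ p, f p ∂D - ε) := by
        rw [integral_add (by fun_prop) (by fun_prop), integral_const_mul,
          integral_sub hf_int (by fun_prop)]
        simp
    _ ≤ ψ ε := by
        have := mul_nonneg ha.1 (sub_nonneg.2 hf_le)
        linarith
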